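/- arXiv:1605.07112 — 6 statements merged into one kernel-verified Lean document; each statement's English description precedes it below -/
import Mathlib

section
/- (Proposition 1, first direction) Consider the distributed gradient-tracking algorithm with each f_i α-strongly convex and β-smooth (0 < α ≤ β) and step size 0 < η < 2/β, and let x* be the unique minimizer of f. If there exist C₁ > 0 and κ₁ ∈ (0,1) such that ‖s(t) − 𝟙g(t)‖ ≤ C₁ κ₁^t for all t ≥ 0, then there exist C > 0 and κ ∈ (0,1) such that ‖x(t) − 𝟙x*‖ ≤ C κ^t for all t ≥ 0. -/
open scoped BigOperators RealInnerProductSpace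
open Filter

noncomputable section

abbrev Vec (N : ℕ) := EuclideanSpace ℝ (Fin N)

/-- Frobenius norm of a stacked matrix in `ℝ^{n×N}`, viewed as `n` rows in `ℝ^N`. -/
def fro {n N : ℕ} (A : Fin n → Vec N) : ℝ := Real.sqrt (∑ i, ‖A i‖ ^ 2)

/-- Spectral norm (largest singular value) of a square real matrix, as the operator norm
of the induced linear map between Euclidean spaces. -/
def specNorm {n : ℕ} (M : Matrix (Fin n) (Fin n) ℝ) : ℝ :=
  ‖LinearMap.toContinuousLinearMap (Matrix.toEuclideanLin M)‖

section SmoothConvex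

variable {E : Type*} [NormedAddCommGroup E] [InnerProductSpace ℝ E] [CompleteSpace E]
  {F : E → ℝ} {G : E → E} {β : ℝ}

/-- The descent lemma: a function with `β`-Lipschitz gradient lies below its quadratic model. -/
theorem le_quadratic_of_lipschitz_gradient (hG : ∀ z, HasGradientAt F (G z) z)
    (hL : ∀ u v, ‖G u - G v‖ ≤ β * ‖u - v‖) (u v : E) :
    F v ≤ F u + ⟪G u, v - u⟫ + β / 2 * ‖v - u‖ ^ 2 := by
  have hφ : ∀ t : ℝ, HasDerivAt
      (fun t : ℝ => F (u + t • (v - u)) - t * ⟪G u, v - u⟫ - t ^ 2 * (β / 2 * ‖v - u‖ ^ 2))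
      (⟪G (u + t • (v - u)), v - u⟫ - ⟪G u, v - u⟫ - 2 * t * (β / 2 * ‖v - u‖ ^ 2)) t := by
    intro t
    have hline : HasDerivAt (fun t : ℝ => u + t • (v - u)) (v - u) t := by
      simpa using ((hasDerivAt_id t).smul_const (v - u)).const_add u
    have hF : HasDerivAt (fun t : ℝ => F (u + t • (v - u))) ⟪G (u + t • (v - u)), v - u⟫ t := by
      exact (hG (u + t • (v - u))).hasFDerivAt.comp_hasDerivAt t hline
    have hlin : HasDerivAt (fun t : ℝ => t * ⟪G u, v - u⟫) ⟪G u, v - u⟫ t := by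
      simpa using (hasDerivAt_id t).mul_const ⟪G u, v - u⟫
    have hsq : HasDerivAt (fun t : ℝ => t ^ 2 * (β / 2 * ‖v - u‖ ^ 2))
        (2 * t * (β / 2 * ‖v - u‖ ^ 2)) t := by
      simpa using (hasDerivAt_pow 2 t).mul_const (β / 2 * ‖v - u‖ ^ 2)
    exact (hF.sub hlin).sub hsq
  have hanti := antitoneOn_of_deriv_nonpos (convex_Icc (0 : ℝ) 1)
    (fun t _ => (hφ t).continuousAt.continuousWithinAt)
    (fun t _ => (hφ t).differentiableAt.differentiableWithinAt) (by
      intro t ht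
      rw [interior_Icc] at ht
      rw [(hφ t).deriv, ← inner_sub_left]
      have hcs := real_inner_le_norm (G (u + t • (v - u)) - G u) (v - u)
      have hlip := hL (u + t • (v - u)) u
      rw [add_sub_cancel_left, norm_smul, Real.norm_of_nonneg ht.1.le] at hlip
      nlinarith [mul_le_mul_of_nonneg_right hlip (norm_nonneg (v - u))])
  have h := hanti (Set.left_mem_Icc.2 zero_le_one) (Set.right_mem_Icc.2 zero_le_one) zero_le_one
  simp only [one_smul, add_sub_cancel, one_mul, zero_smul, add_zero, zero_mul, one_pow] at h
  norm_num at h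
  linarith

theorem gradient_lower_bound_of_convex_smooth (hG : ∀ z, HasGradientAt F (G z) z)
    (hβ : 0 < β) (hL : ∀ u v, ‖G u - G v‖ ≤ β * ‖u - v‖)
    (hconv : ∀ u v, F u + ⟪G u, v - u⟫ ≤ F v) (u v : E) :
    F u + ⟪G u, v - u⟫ + β⁻¹ / 2 * ‖G v - G u‖ ^ 2 ≤ F v := by
  set d := G v - G u with hd
  have hlow := hconv u (v - β⁻¹ • d)
  have hup := le_quadratic_of_lipschitz_gradient hG hL v (v - β⁻¹ • d)
  have hstep : v - β⁻¹ • d - v = -(β⁻¹ • d) := by abel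
  have hsplit : v - β⁻¹ • d - u = (v - u) - β⁻¹ • d := by abel
  rw [hstep, norm_neg, norm_smul, inner_neg_right, real_inner_smul_right,
    Real.norm_of_nonneg (inv_pos.2 hβ).le] at hup
  rw [hsplit, inner_sub_right, real_inner_smul_right] at hlow
  have hdd : ⟪G v, d⟫ - ⟪G u, d⟫ = ‖d‖ ^ 2 := by
    rw [← inner_sub_left, ← hd, real_inner_self_eq_norm_sq]
  have hq : β / 2 * (β⁻¹ * ‖d‖) ^ 2 = β⁻¹ / 2 * ‖d‖ ^ 2 := by field_simp
  rw [hq] at hup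
  linear_combination hlow + hup - β⁻¹ * hdd

/-- Cocoercivity of the gradient of a convex smooth function. -/
theorem gradient_cocoercive (hG : ∀ z, HasGradientAt F (G z) z)
    (hβ : 0 < β) (hL : ∀ u v, ‖G u - G v‖ ≤ β * ‖u - v‖)
    (hconv : ∀ u v, F u + ⟪G u, v - u⟫ ≤ F v) (u v : E) :
    ‖G u - G v‖ ^ 2 ≤ β * ⟪G u - G v, u - v⟫ := by
  have huv := gradient_lower_bound_of_convex_smooth hG hβ hL hconv u v
  have hvu := gradient_lower_bound_of_convex_smooth hG hβ hL hconv v u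
  rw [norm_sub_rev] at huv
  have hinner : ⟪G u - G v, u - v⟫ = -⟪G u, v - u⟫ - ⟪G v, u - v⟫ := by
    rw [inner_sub_left, ← neg_sub v u, inner_neg_right (G u)]
  have h : β⁻¹ * ‖G u - G v‖ ^ 2 ≤ ⟪G u - G v, u - v⟫ := by linarith
  rwa [inv_mul_le_iff₀ hβ] at h

/-- A gradient step of size `η < 2 / β` is a contraction. -/
theorem exists_gradient_step_contraction (hG : ∀ z, HasGradientAt F (G z) z)
    {α η : ℝ} (hα : 0 < α) (hβ : 0 < β) (hL : ∀ u v, ‖G u - G v‖ ≤ β * ‖u - v‖)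
    (hstr : ∀ u v, F u + ⟪G u, v - u⟫ + α / 2 * ‖v - u‖ ^ 2 ≤ F v)
    (hη0 : 0 < η) (hη1 : η < 2 / β) :
    ∃ q : ℝ, 0 ≤ q ∧ q < 1 ∧ ∀ u v, ‖(u - η • G u) - (v - η • G v)‖ ≤ q * ‖u - v‖ := by
  have hηβ : 0 < 2 - η * β := by
    rw [lt_div_iff₀ hβ] at hη1
    linarith
  refine ⟨√(max 0 (1 - α * (η * (2 - η * β)))), Real.sqrt_nonneg _, ?_, fun u v => ?_⟩
  · rw [Real.sqrt_lt' one_pos, max_lt_iff]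
    constructor <;> nlinarith [mul_pos hα (mul_pos hη0 hηβ)]
  · have hconv : ∀ u v, F u + ⟪G u, v - u⟫ ≤ F v := fun u v => by
      nlinarith [hstr u v, mul_nonneg hα.le (sq_nonneg ‖v - u‖)]
    have hco := gradient_cocoercive hG hβ hL hconv u v
    have hmono : α * ‖u - v‖ ^ 2 ≤ ⟪G u - G v, u - v⟫ := by
      have huv := hstr u v
      have hvu := hstr v u
      rw [norm_sub_rev] at huv
      have hinner : ⟪G u - G v, u - v⟫ = -⟪G u, v - u⟫ - ⟪G v, u - v⟫ := by
        rw [inner_sub_left, ← neg_sub v u, inner_neg_right (G u)]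
      linarith
    refine le_of_sq_le_sq ?_ (by positivity)
    rw [mul_pow, Real.sq_sqrt (le_max_left _ _)]
    have hrw : (u - η • G u) - (v - η • G v) = (u - v) - η • (G u - G v) := by
      rw [smul_sub]; abel
    rw [hrw, norm_sub_sq_real, real_inner_smul_right, real_inner_comm, norm_smul,
      Real.norm_of_nonneg hη0.le, mul_pow]
    have hmax := mul_le_mul_of_nonneg_right
      (le_max_right 0 (1 - α * (η * (2 - η * β)))) (sq_nonneg ‖u - v‖)
    have h1 := mul_le_mul_of_nonneg_left hco (sq_nonneg η)
    have h2 := mul_le_mul_of_nonneg_left hmono (mul_pos hη0 hηβ).le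
    linarith

end SmoothConvex

/-- A contraction driven by a geometrically decaying perturbation decays geometrically. -/
theorem exists_geometric_bound {a : ℕ → ℝ} {q κ D : ℝ} (hq0 : 0 ≤ q) (hq1 : q < 1)
    (hκ1 : κ < 1) (hκ0 : 0 < κ) (hD : 0 ≤ D) (ha : ∀ t, a (t + 1) ≤ q * a t + D * κ ^ t) :
    ∃ C ρ : ℝ, 0 < C ∧ κ ≤ ρ ∧ ρ < 1 ∧ ∀ t, a t ≤ C * ρ ^ t := by
  obtain ⟨ρ, hρ, hρ1⟩ := exists_between (max_lt hq1 hκ1)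
  obtain ⟨hqρ, hκρ⟩ := max_lt_iff.1 hρ
  have hgap : 0 < ρ - q := sub_pos.2 hqρ
  set C := |a 0| + D / (ρ - q) + 1 with hC
  have hDC : D ≤ C * (ρ - q) := by
    rw [← div_le_iff₀ hgap, hC]
    linarith [abs_nonneg (a 0)]
  refine ⟨C, ρ, by positivity, hκρ.le, hρ1, fun t => ?_⟩
  induction t with
  | zero =>
    have : 0 ≤ D / (ρ - q) := by positivity
    rw [pow_zero, mul_one, hC]
    linarith [le_abs_self (a 0)]
  | succ t ih =>
    have hρt : 0 ≤ ρ ^ t := pow_nonneg (hκ0.trans hκρ).le t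
    calc a (t + 1) ≤ q * a t + D * κ ^ t := ha t
      _ ≤ q * (C * ρ ^ t) + C * (ρ - q) * ρ ^ t := by gcongr
      _ = C * ρ ^ (t + 1) := by ring

section Frobenius

variable {n N : ℕ}

theorem fro_eq_norm_toLp (A : Fin n → Vec N) : fro A = ‖WithLp.toLp 2 A‖ := by
  rw [PiLp.norm_eq_of_L2, fro]

theorem fro_add_le (A B : Fin n → Vec N) : fro (fun i => A i + B i) ≤ fro A + fro B := by
  simp only [fro_eq_norm_toLp]
  exact norm_add_le (WithLp.toLp 2 A) (WithLp.toLp 2 B)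

theorem fro_sub_le (A B : Fin n → Vec N) : fro (fun i => A i - B i) ≤ fro A + fro B := by
  simp only [fro_eq_norm_toLp]
  exact norm_sub_le (WithLp.toLp 2 A) (WithLp.toLp 2 B)

theorem fro_smul (c : ℝ) (A : Fin n → Vec N) : fro (fun i => c • A i) = |c| * fro A := by
  simp only [fro_eq_norm_toLp]
  exact norm_smul c (WithLp.toLp 2 A)

theorem fro_const (v : Vec N) : fro (fun _ : Fin n => v) = √n * ‖v‖ := by
  simp [fro, Real.sqrt_mul]

theorem norm_row_le_fro (A : Fin n → Vec N) (i : Fin n) : ‖A i‖ ≤ fro A := by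
  rw [fro_eq_norm_toLp]
  exact PiLp.norm_apply_le (WithLp.toLp 2 A) i

theorem fro_matrix_mul_le (M : Matrix (Fin n) (Fin n) ℝ) (A : Fin n → Vec N) :
    fro (fun i => ∑ j, M i j • A j) ≤ specNorm M * fro A := by
  have hnonneg : 0 ≤ specNorm M := norm_nonneg _
  have hcol : ∀ k, ∑ i, (∑ j, M i j * A j k) ^ 2 ≤ specNorm M ^ 2 * ∑ j, A j k ^ 2 := by
    intro k
    have h := (LinearMap.toContinuousLinearMap (Matrix.toEuclideanLin M)).le_opNorm
      (WithLp.toLp 2 fun j => A j k)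
    have h2 := pow_le_pow_left₀ (norm_nonneg _) h 2
    rw [mul_pow, EuclideanSpace.norm_sq_eq, EuclideanSpace.norm_sq_eq] at h2
    simpa [Matrix.toLpLin_apply, Matrix.mulVec, dotProduct, specNorm] using h2
  rw [fro, fro]
  refine Real.sqrt_le_iff.2 ⟨by positivity, ?_⟩
  rw [mul_pow, Real.sq_sqrt (by positivity)]
  simp only [EuclideanSpace.norm_sq_eq, Real.norm_eq_abs, sq_abs]
  rw [Finset.sum_comm, Finset.sum_comm (f := fun i k => (A i k) ^ 2), Finset.mul_sum]
  refine Finset.sum_le_sum fun k _ => ?_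
  simpa using hcol k

end Frobenius

section RowAverage

variable {n N : ℕ}

/-- The average of the rows of a stacked matrix. -/
def rowAvg (A : Fin n → Vec N) : Vec N := (n : ℝ)⁻¹ • ∑ i, A i

theorem rowAvg_sub (A B : Fin n → Vec N) :
    rowAvg (fun i => A i - B i) = rowAvg A - rowAvg B := by
  simp [rowAvg, smul_sub]

theorem rowAvg_add (A B : Fin n → Vec N) :
    rowAvg (fun i => A i + B i) = rowAvg A + rowAvg B := by
  simp [rowAvg, Finset.sum_add_distrib]

theorem rowAvg_smul (c : ℝ) (A : Fin n → Vec N) :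
    rowAvg (fun i => c • A i) = c • rowAvg A := by
  rw [rowAvg, rowAvg, ← Finset.smul_sum, smul_comm]

theorem rowAvg_matrix_mul {W : Matrix (Fin n) (Fin n) ℝ} (hW : ∀ j, ∑ i, W i j = 1)
    (A : Fin n → Vec N) : rowAvg (fun i => ∑ j, W i j • A j) = rowAvg A := by
  rw [rowAvg, rowAvg, Finset.sum_comm]
  simp only [← Finset.sum_smul, hW, one_smul]

theorem norm_rowAvg_le (hn : 0 < n) {A : Fin n → Vec N} {c : ℝ} (hA : ∀ i, ‖A i‖ ≤ c) :
    ‖rowAvg A‖ ≤ c := by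
  have hn' : (0 : ℝ) < n := Nat.cast_pos.2 hn
  rw [rowAvg, norm_smul, norm_inv, RCLike.norm_natCast, inv_mul_le_iff₀ hn']
  simpa using norm_sum_le_of_le Finset.univ fun i _ => hA i

/-- Subtracting the averaging matrix from a row-stochastic `W` and then acting on the deviations
from the average gives the deviation of `W A` from the average of `A`. -/
theorem matrix_sub_avg_mul_deviation (hn : 0 < n) {W : Matrix (Fin n) (Fin n) ℝ}
    (hW : ∀ i, ∑ j, W i j = 1) (A : Fin n → Vec N) (i : Fin n) :
    ∑ j, (W - (n : ℝ)⁻¹ • Matrix.of (fun _ _ => (1 : ℝ)) : Matrix (Fin n) (Fin n) ℝ) i j •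
        (A j - rowAvg A) =
      (∑ j, W i j • A j) - rowAvg A := by
  have hn' : (n : ℝ) ≠ 0 := Nat.cast_ne_zero.2 hn.ne'
  simp only [Matrix.sub_apply, Matrix.smul_apply, Matrix.of_apply, smul_eq_mul, mul_one,
    smul_sub, sub_smul, Finset.sum_sub_distrib, ← Finset.sum_smul, hW, one_smul,
    ← Finset.smul_sum]
  simp [rowAvg, hn']

end RowAverage

theorem statement14
    {n N : ℕ} (hn : 0 < n)
    (α β : ℝ) (hα : 0 < α) (hαβ : α ≤ β)
    (f : Fin n → Vec N → ℝ)
    (hdiff : ∀ i, Differentiable ℝ (f i))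
    (hstr : ∀ i, ∀ u v : Vec N,
      f i u + ⟪gradient (f i) u, v - u⟫ + α / 2 * ‖v - u‖ ^ 2 ≤ f i v)
    (hsmooth : ∀ i, ∀ u v : Vec N,
      ‖gradient (f i) u - gradient (f i) v‖ ≤ β * ‖u - v‖)
    (favg : Vec N → ℝ) (hfavg : ∀ z, favg z = (n : ℝ)⁻¹ * ∑ i, f i z)
    (xstar : Vec N) (hmin : ∀ z, favg xstar ≤ favg z)
    (W : Matrix (Fin n) (Fin n) ℝ)
    (hWnonneg : ∀ i j, 0 ≤ W i j)
    (hWrow : ∀ i, ∑ j, W i j = 1)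
    (hWcol : ∀ j, ∑ i, W i j = 1)
    (σ : ℝ)
    (hσ : σ = specNorm (W - (n : ℝ)⁻¹ • Matrix.of (fun _ _ => (1 : ℝ))))
    (hσ0 : 0 < σ) (hσ1 : σ < 1)
    (η : ℝ) (hη0 : 0 < η) (hη1 : η < 2 / β)
    (x s : ℕ → Fin n → Vec N)
    (hs0 : ∀ i, s 0 i = gradient (f i) (x 0 i))
    (hxupd : ∀ t i, x (t + 1) i = (∑ j, W i j • x t j) - η • s t i)
    (hsupd : ∀ t i, s (t + 1) i =
      (∑ j, W i j • s t j) + gradient (f i) (x (t + 1) i) - gradient (f i) (x t i))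
    (g : ℕ → Vec N)
    (hg : ∀ t, g t = (n : ℝ)⁻¹ • ∑ i, gradient (f i) (x t i))
    (C₁ κ₁ : ℝ) (hC₁ : 0 < C₁) (hκ₁0 : 0 < κ₁) (hκ₁1 : κ₁ < 1)
    (hlin : ∀ t : ℕ, fro (fun i => s t i - g t) ≤ C₁ * κ₁ ^ t) :
    ∃ C κ : ℝ, 0 < C ∧ 0 < κ ∧ κ < 1 ∧
      ∀ t : ℕ, fro (fun i => x t i - xstar) ≤ C * κ ^ t := by
  have hβ : 0 < β := hα.trans_le hαβ
  have hn' : (0 : ℝ) < n := Nat.cast_pos.2 hn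
  set G : Vec N → Vec N := fun z => rowAvg fun i => gradient (f i) z with hGdef
  have hG : ∀ z, HasGradientAt favg (G z) z := by
    intro z
    rw [hasGradientAt_iff_hasFDerivAt, funext hfavg]
    have h := (HasFDerivAt.fun_sum (u := Finset.univ) fun i _ =>
      ((hdiff i) z).hasGradientAt.hasFDerivAt).const_mul (n : ℝ)⁻¹
    simpa [hGdef, rowAvg] using h
  have hL : ∀ u v, ‖G u - G v‖ ≤ β * ‖u - v‖ := by
    intro u v
    rw [hGdef, ← rowAvg_sub]
    exact norm_rowAvg_le hn fun i => hsmooth i u v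
  have hstrong : ∀ u v, favg u + ⟪G u, v - u⟫ + α / 2 * ‖v - u‖ ^ 2 ≤ favg v := by
    intro u v
    have h := Finset.sum_le_sum fun i (_ : i ∈ Finset.univ) => hstr i u v
    simp only [Finset.sum_add_distrib, Finset.sum_const, Finset.card_univ, Fintype.card_fin,
      nsmul_eq_mul] at h
    have h' := mul_le_mul_of_nonneg_left h (inv_pos.2 hn').le
    rw [mul_add, mul_add, inv_mul_cancel_left₀ hn'.ne'] at h'
    simpa only [hfavg, hGdef, rowAvg, real_inner_smul_left, sum_inner] using h'
  have hGstar : G xstar = 0 := by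
    have h := IsLocalMin.hasFDerivAt_eq_zero (Eventually.of_forall hmin) (hG xstar).hasFDerivAt
    simpa using h
  have hsavg : ∀ t, rowAvg (s t) = g t := by
    intro t
    induction t with
    | zero => simp only [rowAvg, hs0, hg]
    | succ t ih =>
      rw [funext (hsupd t), rowAvg_sub, rowAvg_add, rowAvg_matrix_mul hWcol, ih]
      rw [hg t, hg (t + 1), rowAvg, rowAvg]
      abel
  have hxavg : ∀ t, rowAvg (x (t + 1)) = rowAvg (x t) - η • g t := by
    intro t
    rw [funext (hxupd t), rowAvg_sub, rowAvg_matrix_mul hWcol, rowAvg_smul, hsavg]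
  have hcons : ∀ t, fro (fun i => x (t + 1) i - rowAvg (x (t + 1))) ≤
      σ * fro (fun i => x t i - rowAvg (x t)) + η * C₁ * κ₁ ^ t := by
    intro t
    have hrow : (fun i => x (t + 1) i - rowAvg (x (t + 1))) = fun i =>
        (∑ j, (W - (n : ℝ)⁻¹ • Matrix.of (fun _ _ => (1 : ℝ)) : Matrix (Fin n) (Fin n) ℝ) i j •
          (x t j - rowAvg (x t))) -
          η • (s t i - g t) := by
      funext i
      rw [matrix_sub_avg_mul_deviation hn hWrow, hxavg, hxupd, smul_sub]
      abel
    rw [hrow]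
    refine (fro_sub_le _ _).trans (add_le_add ?_ ?_)
    · rw [hσ]
      exact fro_matrix_mul_le _ _
    · rw [fro_smul, abs_of_pos hη0, mul_assoc]
      exact mul_le_mul_of_nonneg_left (hlin t) hη0.le
  obtain ⟨C₂, κ₂, hC₂, hκ₁₂, hκ₂, hdev⟩ :=
    exists_geometric_bound (a := fun t => fro (fun i => x t i - rowAvg (x t))) hσ0.le hσ1
      hκ₁1 hκ₁0 (mul_pos hη0 hC₁).le hcons
  have hκ₂0 : 0 < κ₂ := hκ₁0.trans_le hκ₁₂
  have hgerr : ∀ t, ‖G (rowAvg (x t)) - g t‖ ≤ β * (C₂ * κ₂ ^ t) := by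
    intro t
    have hgt : g t = rowAvg fun i => gradient (f i) (x t i) := hg t
    rw [hgt, hGdef, ← rowAvg_sub]
    refine norm_rowAvg_le hn fun i => (hsmooth i _ _).trans ?_
    rw [norm_sub_rev]
    exact mul_le_mul_of_nonneg_left
      ((norm_row_le_fro (fun i => x t i - rowAvg (x t)) i).trans (hdev t)) hβ.le
  obtain ⟨q, hq0, hq1, hq⟩ := exists_gradient_step_contraction hG hα hβ hL hstrong hη0 hη1
  have hopt : ∀ t, ‖rowAvg (x (t + 1)) - xstar‖ ≤
      q * ‖rowAvg (x t) - xstar‖ + η * (β * C₂) * κ₂ ^ t := by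
    intro t
    have hsplit : rowAvg (x (t + 1)) - xstar =
        ((rowAvg (x t) - η • G (rowAvg (x t))) - (xstar - η • G xstar)) +
          η • (G (rowAvg (x t)) - g t) := by
      rw [hxavg, hGstar, smul_zero, smul_sub]
      abel
    rw [hsplit]
    refine (norm_add_le _ _).trans (add_le_add (hq _ _) ?_)
    rw [norm_smul, Real.norm_of_nonneg hη0.le, mul_assoc, mul_assoc]
    exact mul_le_mul_of_nonneg_left (hgerr t) hη0.le
  obtain ⟨C₃, κ₃, hC₃, hκ₂₃, hκ₃, hmean⟩ :=
    exists_geometric_bound (a := fun t => ‖rowAvg (x t) - xstar‖) hq0 hq1 hκ₂ hκ₂0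
      (by positivity) hopt
  refine ⟨C₂ + √n * C₃, κ₃, by positivity, hκ₂0.trans_le hκ₂₃, hκ₃, fun t => ?_⟩
  have hsplit : (fun i => x t i - xstar) =
      fun i => (x t i - rowAvg (x t)) + (rowAvg (x t) - xstar) := by
    funext i
    abel
  calc fro (fun i => x t i - xstar)
      ≤ fro (fun i => x t i - rowAvg (x t)) + √n * ‖rowAvg (x t) - xstar‖ := by
        rw [hsplit, ← fro_const]
        exact fro_add_le _ _
    _ ≤ C₂ * κ₃ ^ t + √n * (C₃ * κ₃ ^ t) := by
        gcongr
        · exact (hdev t).trans (by gcongr)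
        · exact hmean t
    _ = (C₂ + √n * C₃) * κ₃ ^ t := by ring
end
end

section
/- (Proposition 1, second direction) Consider the distributed gradient-tracking algorithm with each f_i β-smooth (β > 0), and let x* ∈ ℝ^N. If there exist C > 0 and κ ∈ (0,1) such that ‖x(t) − 𝟙x*‖ ≤ C κ^t for all t ≥ 0, then there exist C′ > 0 and κ′ ∈ (0,1) such that ‖s(t) − 𝟙g(t)‖ ≤ C′ κ′^t for all t ≥ 0. -/
open scoped BigOperators RealInnerProductSpace
open Filter

noncomputable section

/-- Every row norm is bounded by the Frobenius norm. -/
theorem norm_le_fro {n N : ℕ} (A : Fin n → Vec N) (i : Fin n) : ‖A i‖ ≤ fro A :=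
  Real.le_sqrt_of_sq_le <|
    Finset.single_le_sum (f := fun i => ‖A i‖ ^ 2) (fun _ _ => sq_nonneg _) (Finset.mem_univ i)

/-- A uniform bound on the row norms bounds the Frobenius norm. -/
theorem fro_le_sqrt_mul {n N : ℕ} (A : Fin n → Vec N) {c : ℝ} (hc : 0 ≤ c)
    (h : ∀ i, ‖A i‖ ≤ c) : fro A ≤ √n * c := by
  have hsum : ∑ i, ‖A i‖ ^ 2 ≤ n * c ^ 2 := by
    calc ∑ i, ‖A i‖ ^ 2 ≤ ∑ _i : Fin n, c ^ 2 :=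
          Finset.sum_le_sum fun i _ => pow_le_pow_left₀ (norm_nonneg _) (h i) 2
      _ = n * c ^ 2 := by simp
  calc fro A ≤ √(n * c ^ 2) := Real.sqrt_le_sqrt hsum
    _ = √n * c := by rw [Real.sqrt_mul n.cast_nonneg, Real.sqrt_sq hc]

/-- Averaging with a column-stochastic matrix preserves the sum of the rows. -/
theorem sum_sum_smul_of_col_sum {n N : ℕ} {W : Matrix (Fin n) (Fin n) ℝ}
    (hWcol : ∀ j, ∑ i, W i j = 1) (A : Fin n → Vec N) :
    ∑ i, ∑ j, W i j • A j = ∑ j, A j := by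
  rw [Finset.sum_comm]
  exact Finset.sum_congr rfl fun j _ => by rw [← Finset.sum_smul, hWcol, one_smul]

/-- A weighted average with row-stochastic weights stays as close to a point as the rows do. -/
theorem norm_sum_smul_sub_le {n N : ℕ} {w : Fin n → ℝ} (hw : ∀ j, 0 ≤ w j)
    (hw1 : ∑ j, w j = 1) (A : Fin n → Vec N) (v : Vec N) {c : ℝ}
    (h : ∀ j, ‖A j - v‖ ≤ c) : ‖(∑ j, w j • A j) - v‖ ≤ c := by
  have heq : (∑ j, w j • A j) - v = ∑ j, w j • (A j - v) := by
    simp only [smul_sub, Finset.sum_sub_distrib]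
    rw [← Finset.sum_smul, hw1, one_smul]
  calc ‖(∑ j, w j • A j) - v‖ ≤ ∑ j, ‖w j • (A j - v)‖ := heq ▸ norm_sum_le _ _
    _ ≤ ∑ j, w j * c := Finset.sum_le_sum fun j _ => by
        rw [norm_smul, Real.norm_of_nonneg (hw j)]
        exact mul_le_mul_of_nonneg_left (h j) (hw j)
    _ = c := by rw [← Finset.sum_mul, hw1, one_mul]

theorem statement15
    {n N : ℕ} (hn : 0 < n)
    (β : ℝ) (hβ : 0 < β)
    (f : Fin n → Vec N → ℝ)
    (hdiff : ∀ i, Differentiable ℝ (f i))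
    (hsmooth : ∀ i, ∀ u v : Vec N,
      ‖gradient (f i) u - gradient (f i) v‖ ≤ β * ‖u - v‖)
    (W : Matrix (Fin n) (Fin n) ℝ)
    (hWnonneg : ∀ i j, 0 ≤ W i j)
    (hWrow : ∀ i, ∑ j, W i j = 1)
    (hWcol : ∀ j, ∑ i, W i j = 1)
    (σ : ℝ)
    (hσ : σ = specNorm (W - (n : ℝ)⁻¹ • Matrix.of (fun _ _ => (1 : ℝ))))
    (hσ0 : 0 < σ) (hσ1 : σ < 1)
    (η : ℝ) (hη : 0 < η)
    (x s : ℕ → Fin n → Vec N)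
    (hs0 : ∀ i, s 0 i = gradient (f i) (x 0 i))
    (hxupd : ∀ t i, x (t + 1) i = (∑ j, W i j • x t j) - η • s t i)
    (hsupd : ∀ t i, s (t + 1) i =
      (∑ j, W i j • s t j) + gradient (f i) (x (t + 1) i) - gradient (f i) (x t i))
    (g : ℕ → Vec N)
    (hg : ∀ t, g t = (n : ℝ)⁻¹ • ∑ i, gradient (f i) (x t i))
    (xstar : Vec N)
    (C κ : ℝ) (hC : 0 < C) (hκ0 : 0 < κ) (hκ1 : κ < 1)
    (hlin : ∀ t : ℕ, fro (fun i => x t i - xstar) ≤ C * κ ^ t) :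
    ∃ C' κ' : ℝ, 0 < C' ∧ 0 < κ' ∧ κ' < 1 ∧
      ∀ t : ℕ, fro (fun i => s t i - g t) ≤ C' * κ' ^ t := by
  have hn' : (0 : ℝ) < n := by exact_mod_cast hn
  have hx : ∀ t i, ‖x t i - xstar‖ ≤ C * κ ^ t := fun t i =>
    (norm_le_fro (fun i => x t i - xstar) i).trans (hlin t)
  have hs : ∀ t i, ‖s t i‖ ≤ 2 * C / η * κ ^ t := by
    intro t i
    have heq : η • s t i = ((∑ j, W i j • x t j) - xstar) - (x (t + 1) i - xstar) := by
      rw [hxupd]; abel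
    have hstep : κ ^ (t + 1) ≤ κ ^ t := pow_le_pow_of_le_one hκ0.le hκ1.le t.le_succ
    have hbound : η * ‖s t i‖ ≤ 2 * C * κ ^ t := by
      calc η * ‖s t i‖ = ‖η • s t i‖ := by rw [norm_smul, Real.norm_of_nonneg hη.le]
        _ ≤ C * κ ^ t + C * κ ^ (t + 1) := heq ▸ (norm_sub_le _ _).trans
            (add_le_add (norm_sum_smul_sub_le (hWnonneg i) (hWrow i) _ _ (hx t)) (hx (t + 1) i))
        _ ≤ 2 * C * κ ^ t := by nlinarith
    rw [div_mul_eq_mul_div, le_div_iff₀ hη]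
    linarith
  have htrack : ∀ t, ∑ i, s t i = ∑ i, gradient (f i) (x t i) := by
    intro t
    induction t with
    | zero => exact Finset.sum_congr rfl fun i _ => hs0 i
    | succ t ih =>
      simp only [hsupd, Finset.sum_sub_distrib, Finset.sum_add_distrib]
      rw [sum_sum_smul_of_col_sum hWcol, ih]
      abel
  have hgs : ∀ t, ‖g t‖ ≤ 2 * C / η * κ ^ t := by
    intro t
    have hmean : g t = (∑ i, (n : ℝ)⁻¹ • s t i) - 0 := by
      rw [hg, ← htrack, Finset.smul_sum, sub_zero]
    rw [hmean]
    refine norm_sum_smul_sub_le (fun _ => (inv_pos.2 hn').le) ?_ _ _ fun j => ?_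
    · simp [hn'.ne']
    · simpa using hs t j
  refine ⟨√n * (4 * C / η), κ, by positivity, hκ0, hκ1, fun t => ?_⟩
  rw [mul_assoc]
  refine fro_le_sqrt_mul _ (by positivity) fun i => ?_
  calc ‖s t i - g t‖ ≤ 2 * C / η * κ ^ t + 2 * C / η * κ ^ t :=
        (norm_sub_le _ _).trans (add_le_add (hs t i) (hgs t))
    _ = 4 * C / η * κ ^ t := by ring
end
end

section
/- (Theorem 3, impossibility of linear convergence without history) Fix 0 < α ≤ β and L > 0. Let Y be a topological space, H : ℝ^N × ℝ^N → Y a continuous map, F : Y × ℝ^N → ℝ^N a continuous map such that for every y ∈ Y the map v ↦ F(y, v) is L-Lipschitz, and let (η_t)_{t≥0} be a real sequence converging to some limit η*. For functions f₁, f₂ : ℝ^N → ℝ and initial points x₁(0), x₂(0), consider the two-agent dynamics x₁(t+1) = F(H(x₁(t), x₂(t)), η_t ∇f₁(x₁(t))) and x₂(t+1) = F(H(x₂(t), x₁(t)), η_t ∇f₂(x₂(t))). Suppose that for every pair f₁, f₂ of α-strongly convex, β-smooth functions and every pair of initial points, both sequences x₁(t), x₂(t) converge to the unique minimizer x* of f₁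 + f₂. Then there exist α-strongly convex, β-smooth functions f₁, f₂ and initial points x₁(0), x₂(0) such that, with x* the minimizer of f₁ + f₂, for every δ ∈ (0,1) and every T ≥ 0 there exists t ≥ T with ‖x₁(t+1) − x*‖ ≥ δ ‖x₁(t) − x*‖. -/
open scoped BigOperators RealInnerProductSpace
open Filter

noncomputable section

/-- `f` is `α`-strongly convex and `β`-smooth. -/
def StronglyConvexSmooth {N : ℕ} (α β : ℝ) (f : Vec N → ℝ) : Prop :=
  Differentiable ℝ f ∧
  (∀ u v : Vec N, f u + ⟪gradient f u, v - u⟫ + α / 2 * ‖v - u‖ ^ 2 ≤ f v) ∧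
  (∀ u v : Vec N, ‖gradient f u - gradient f v‖ ≤ β * ‖u - v‖)

/-- The quadratic `z ↦ α / 2 * ‖z - x‖ ^ 2 + ⟪v, z - x⟫`. -/
def tiltedQuadratic {N : ℕ} (α : ℝ) (x v : Vec N) (z : Vec N) : ℝ :=
  α / 2 * ‖z - x‖ ^ 2 + ⟪v, z - x⟫

theorem hasGradientAt_tiltedQuadratic {N : ℕ} (α : ℝ) (x v z : Vec N) :
    HasGradientAt (tiltedQuadratic α x v) (α • (z - x) + v) z := by
  rw [hasGradientAt_iff_hasFDerivAt]
  have hsub : HasFDerivAt (fun z : Vec N => z - x) (ContinuousLinearMap.id ℝ (Vec N)) z :=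
    (hasFDerivAt_id z).sub_const x
  have hinner := (innerSL ℝ v).hasFDerivAt.comp z hsub
  refine ((hsub.norm_sq.const_mul (α / 2)).add hinner).congr_fderiv ?_
  ext w
  simp
  ring

theorem gradient_tiltedQuadratic {N : ℕ} (α : ℝ) (x v z : Vec N) :
    gradient (tiltedQuadratic α x v) z = α • (z - x) + v :=
  (hasGradientAt_tiltedQuadratic α x v z).gradient

theorem stronglyConvexSmooth_tiltedQuadratic {N : ℕ} {α β : ℝ} (hα : 0 < α) (hαβ : α ≤ β)
    (x v : Vec N) : StronglyConvexSmooth α β (tiltedQuadratic α x v) := by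
  refine ⟨fun z => (hasGradientAt_tiltedQuadratic α x v z).differentiableAt, ?_, ?_⟩
  · intro u w
    refine le_of_eq ?_
    have hw : w - x = (u - x) + (w - u) := by abel
    rw [gradient_tiltedQuadratic, tiltedQuadratic, tiltedQuadratic, hw, norm_add_sq_real,
      inner_add_right, inner_add_left, real_inner_smul_left]
    ring
  · intro u w
    have h : α • (u - x) + v - (α • (w - x) + v) = α • (u - w) := by module
    rw [gradient_tiltedQuadratic, gradient_tiltedQuadratic, h, norm_smul, Real.norm_of_nonneg hα.le]
    gcongr

theorem tiltedQuadratic_add_neg_min {N : ℕ} {α : ℝ} (hα : 0 < α) (x v z : Vec N) :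
    tiltedQuadratic α x v x + tiltedQuadratic α x (-v) x
      ≤ tiltedQuadratic α x v z + tiltedQuadratic α x (-v) z := by
  simp only [tiltedQuadratic, sub_self, norm_zero, inner_zero_right, inner_neg_left]
  have : 0 ≤ α / 2 * ‖z - x‖ ^ 2 := by positivity
  linarith

/-- Two coupled recursions have a solution from any pair of initial points. -/
theorem exists_coupled_seq {E : Type*} (G₁ G₂ : ℕ → E → E → E) (a b : E) :
    ∃ x₁ x₂ : ℕ → E, x₁ 0 = a ∧ x₂ 0 = b ∧
      (∀ t, x₁ (t + 1) = G₁ t (x₁ t) (x₂ t)) ∧ (∀ t, x₂ (t + 1) = G₂ t (x₂ t) (x₁ t)) := by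
  let p : ℕ → E × E := fun n =>
    Nat.rec (a, b) (fun t q => (G₁ t q.1 q.2, G₂ t q.2 q.1)) n
  exact ⟨fun t => (p t).1, fun t => (p t).2, rfl, rfl, fun _ => rfl, fun _ => rfl⟩

theorem statement16
    {N : ℕ} (α β L : ℝ)
    (hα : 0 < α) (hαβ : α ≤ β) (hL : 0 < L)
    (Y : Type*) [TopologicalSpace Y]
    (H : Vec N → Vec N → Y)
    (hHcont : Continuous fun p : Vec N × Vec N => H p.1 p.2)
    (F : Y → Vec N → Vec N)
    (hFcont : Continuous fun p : Y × Vec N => F p.1 p.2)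
    (hFlip : ∀ (y : Y) (v v' : Vec N), ‖F y v - F y v'‖ ≤ L * ‖v - v'‖)
    (η : ℕ → ℝ) (ηstar : ℝ)
    (hηlim : Tendsto η atTop (nhds ηstar))
    (hconv : ∀ f₁ f₂ : Vec N → ℝ,
      StronglyConvexSmooth α β f₁ → StronglyConvexSmooth α β f₂ →
      ∀ x₁ x₂ : ℕ → Vec N,
        (∀ t, x₁ (t + 1) = F (H (x₁ t) (x₂ t)) (η t • gradient f₁ (x₁ t))) →
        (∀ t, x₂ (t + 1) = F (H (x₂ t) (x₁ t)) (η t • gradient f₂ (x₂ t))) →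
        ∀ xstar : Vec N, (∀ z, f₁ xstar + f₂ xstar ≤ f₁ z + f₂ z) →
          Tendsto x₁ atTop (nhds xstar) ∧ Tendsto x₂ atTop (nhds xstar)) :
    ∃ f₁ f₂ : Vec N → ℝ,
      StronglyConvexSmooth α β f₁ ∧ StronglyConvexSmooth α β f₂ ∧
      ∃ x₁ x₂ : ℕ → Vec N,
        (∀ t, x₁ (t + 1) = F (H (x₁ t) (x₂ t)) (η t • gradient f₁ (x₁ t))) ∧
        (∀ t, x₂ (t + 1) = F (H (x₂ t) (x₁ t)) (η t • gradient f₂ (x₂ t))) ∧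
        ∃ xstar : Vec N, (∀ z, f₁ xstar + f₂ xstar ≤ f₁ z + f₂ z) ∧
          ∀ δ : ℝ, 0 < δ → δ < 1 → ∀ T : ℕ, ∃ t ≥ T,
            δ * ‖x₁ t - xstar‖ ≤ ‖x₁ (t + 1) - xstar‖ := by
  have key : ∀ x v : Vec N, F (H x x) (ηstar • v) = x := by
    intro x v
    obtain ⟨x₁, x₂, -, -, h₁, h₂⟩ := exists_coupled_seq
      (fun t a b => F (H a b) (η t • gradient (tiltedQuadratic α x v) a))
      (fun t a b => F (H a b) (η t • gradient (tiltedQuadratic α x (-v)) a)) x x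
    obtain ⟨hx₁, hx₂⟩ := hconv _ _ (stronglyConvexSmooth_tiltedQuadratic hα hαβ x v)
      (stronglyConvexSmooth_tiltedQuadratic hα hαβ x (-v)) x₁ x₂ h₁ h₂ x
      (tiltedQuadratic_add_neg_min hα x v)
    have hgrad : Tendsto (fun t => η t • gradient (tiltedQuadratic α x v) (x₁ t)) atTop
        (nhds (ηstar • v)) := by
      simp only [gradient_tiltedQuadratic]
      simpa using hηlim.smul (((hx₁.sub_const x).const_smul α).add_const v)
    have hH : Tendsto (fun t => H (x₁ t) (x₂ t)) atTop (nhds (H x x)) :=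
      (hHcont.tendsto (x, x)).comp (hx₁.prodMk_nhds hx₂)
    have hF := (hFcont.tendsto (H x x, ηstar • v)).comp (hH.prodMk_nhds hgrad)
    refine tendsto_nhds_unique hF ?_
    exact ((tendsto_add_atTop_iff_nat 1).2 hx₁).congr h₁
  obtain ⟨x, _, -, -, hx, -⟩ := exists_coupled_seq
    (fun t a _ => F (H a a) (η t • gradient (tiltedQuadratic α (0 : Vec N) 0) a))
    (fun _ a _ => a) (WithLp.toLp 2 fun _ => 1) 0
  refine ⟨tiltedQuadratic α 0 0, tiltedQuadratic α 0 0,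
    stronglyConvexSmooth_tiltedQuadratic hα hαβ 0 0,
    stronglyConvexSmooth_tiltedQuadratic hα hαβ 0 0, x, x, hx, hx, 0,
    fun z => by simpa using tiltedQuadratic_add_neg_min hα (0 : Vec N) 0 z, ?_⟩
  intro δ _ hδ T
  have hsmall : Tendsto (fun t => L * (|η t - ηstar| * α)) atTop (nhds 0) := by
    simpa using (((hηlim.sub_const ηstar).abs).mul_const α).const_mul L
  obtain ⟨t, ht, hT⟩ := ((hsmall.eventually_lt_const (sub_pos.2 hδ)).and
    (eventually_ge_atTop T)).exists
  refine ⟨t, hT, ?_⟩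
  have hstep : ‖x (t + 1) - x t‖ ≤ L * (|η t - ηstar| * α) * ‖x t‖ := by
    calc ‖x (t + 1) - x t‖
        = ‖F (H (x t) (x t)) (η t • α • x t) - F (H (x t) (x t)) (ηstar • α • x t)‖ := by
          rw [key, hx t, gradient_tiltedQuadratic, sub_zero, add_zero]
      _ ≤ L * ‖η t • α • x t - ηstar • α • x t‖ := hFlip _ _ _
      _ = L * (|η t - ηstar| * α) * ‖x t‖ := by
          rw [← sub_smul, norm_smul, norm_smul, Real.norm_eq_abs, Real.norm_of_nonneg hα.le]
          ring
  have htri : ‖x t‖ - ‖x (t + 1)‖ ≤ ‖x (t + 1) - x t‖ := by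
    rw [norm_sub_rev]
    exact norm_sub_norm_le _ _
  have hmul := mul_le_mul_of_nonneg_right ht.le (norm_nonneg (x t))
  rw [sub_zero, sub_zero]
  linarith
end
end

section
/- (Key step of Theorem 3) Fix 0 < α ≤ β. Let F̃ : ℝ^N × ℝ^N → ℝ^N be continuous and let (η_t)_{t≥0} be a real sequence converging to 0. Suppose that for every α-strongly convex, β-smooth function f : ℝ^N → ℝ and every initial point x(0) ∈ ℝ^N, the sequence defined by x(t+1) = F̃(x(t), η_t ∇f(x(t))) converges to the unique minimizer of f. Then F̃(u, 0) = u for every u ∈ ℝ^N. -/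
open scoped BigOperators RealInnerProductSpace
open Filter

noncomputable section

lemma hasGradientAt_half_mul_norm_sub_sq {N : ℕ} (α : ℝ) (c z : Vec N) :
    HasGradientAt (fun w : Vec N => α / 2 * ‖w - c‖ ^ 2) (α • (z - c)) z := by
  rw [hasGradientAt_iff_hasFDerivAt]
  have h := (((hasFDerivAt_id z).sub_const c).norm_sq).const_mul (α / 2)
  refine h.congr_fderiv ?_
  ext w
  simp
  ring

lemma gradient_half_mul_norm_sub_sq {N : ℕ} (α : ℝ) (c z : Vec N) :
    gradient (fun w : Vec N => α / 2 * ‖w - c‖ ^ 2) z = α • (z - c) :=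
  (hasGradientAt_half_mul_norm_sub_sq α c z).gradient

lemma stronglyConvexSmooth_half_mul_norm_sub_sq {N : ℕ} {α β : ℝ} (hα : 0 < α) (hαβ : α ≤ β)
    (c : Vec N) : StronglyConvexSmooth α β (fun w : Vec N => α / 2 * ‖w - c‖ ^ 2) := by
  refine ⟨fun z => (hasGradientAt_half_mul_norm_sub_sq α c z).differentiableAt, ?_, ?_⟩
  · intro u v
    have h : ‖v - c‖ ^ 2 = ‖u - c‖ ^ 2 + 2 * ⟪u - c, v - u⟫ + ‖v - u‖ ^ 2 := by
      rw [← norm_add_sq_real, add_comm, sub_add_sub_cancel]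
    simp only [gradient_half_mul_norm_sub_sq, h, real_inner_smul_left]
    linarith
  · intro u v
    rw [gradient_half_mul_norm_sub_sq, gradient_half_mul_norm_sub_sq, ← smul_sub,
      sub_sub_sub_cancel_right, norm_smul, Real.norm_of_nonneg hα.le]
    gcongr

theorem statement17
    {N : ℕ} (α β : ℝ)
    (hα : 0 < α) (hαβ : α ≤ β)
    (Ftil : Vec N → Vec N → Vec N)
    (hFcont : Continuous fun p : Vec N × Vec N => Ftil p.1 p.2)
    (η : ℕ → ℝ)
    (hηlim : Tendsto η atTop (nhds 0))
    (hconv : ∀ f : Vec N → ℝ, StronglyConvexSmooth α β f →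
      ∀ x : ℕ → Vec N,
        (∀ t, x (t + 1) = Ftil (x t) (η t • gradient f (x t))) →
        ∀ xstar : Vec N, (∀ z, f xstar ≤ f z) →
          Tendsto x atTop (nhds xstar)) :
    ∀ u : Vec N, Ftil u 0 = u := by
  intro u
  set f : Vec N → ℝ := fun w => α / 2 * ‖w - u‖ ^ 2 with hf
  let x : ℕ → Vec N := fun t =>
    Nat.rec u (fun t y => Ftil y (η t • gradient f y)) t
  have hx : ∀ t, x (t + 1) = Ftil (x t) (η t • gradient f (x t)) := fun _ => rfl
  have hlim : Tendsto x atTop (nhds u) := by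
    refine hconv f (stronglyConvexSmooth_half_mul_norm_sub_sq hα hαβ u) x hx u fun z => ?_
    simp only [hf, sub_self, norm_zero]
    have : 0 ≤ α / 2 * ‖z - u‖ ^ 2 := by positivity
    simpa using this
  have hstep : Tendsto (fun t => η t • gradient f (x t)) atTop (nhds 0) := by
    have h := hηlim.smul ((hlim.sub_const u).const_smul α)
    simpa only [hf, gradient_half_mul_norm_sub_sq, zero_smul] using h
  have hF : Tendsto (fun t => x (t + 1)) atTop (nhds (Ftil u 0)) :=
    (hFcont.tendsto (u, 0)).comp (hlim.prodMk_nhds hstep)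
  exact tendsto_nhds_unique hF (hlim.comp (tendsto_add_atTop_nat 1))
end
end

section
/- (Inexact gradient property of the average gradient) Let f₁,…,f_n : ℝ^N → ℝ be convex and β-smooth, and set f = (1/n)Σ_{i=1}^n f_i. Let x₁,…,x_n ∈ ℝ^N, let x̄ = (1/n)Σ_{i=1}^n x_i, g = (1/n)Σ_{i=1}^n ∇f_i(x_i), and f̂ = (1/n)Σ_{i=1}^n [ f_i(x_i) + ⟨∇f_i(x_i), x̄ − x_i⟩ ]. Then for every ω ∈ ℝ^N: (i) f(ω) ≥ f̂ + ⟨g, ω − x̄⟩, and (ii) f(ω) ≤ f̂ + ⟨g, ω − x̄⟩ + β‖ω − x̄‖² + (β/n)·Σ_{i=1}^n ‖x_i − x̄‖². -/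
open scoped BigOperators RealInnerProductSpace
open Filter

noncomputable section

/-- The derivative of `f` along the line `t ↦ x + t • d`. -/
lemma hasDerivAt_comp_add_smul {E : Type*} [NormedAddCommGroup E] [InnerProductSpace ℝ E]
    [CompleteSpace E] {f : E → ℝ} (hf : Differentiable ℝ f) (x d : E) (t : ℝ) :
    HasDerivAt (fun s : ℝ => f (x + s • d)) ⟪gradient f (x + t • d), d⟫ t := by
  have hline : HasDerivAt (fun s : ℝ => x + s • d) d t := by
    simpa using ((hasDerivAt_id t).smul_const d).const_add x
  have h := (hf (x + t • d)).hasFDerivAt.comp_hasDerivAt t hline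
  rwa [← inner_gradient_left] at h

/-- The first-order lower bound for a differentiable convex function. -/
lemma ConvexOn.add_inner_gradient_le {E : Type*} [NormedAddCommGroup E] [InnerProductSpace ℝ E]
    [CompleteSpace E] {f : E → ℝ} (hc : ConvexOn ℝ Set.univ f) (hf : Differentiable ℝ f)
    (x y : E) : f x + ⟪gradient f x, y - x⟫ ≤ f y := by
  have hline : ConvexOn ℝ Set.univ (fun s : ℝ => f (x + s • (y - x))) := by
    have h := hc.comp_affineMap (AffineMap.lineMap x y : ℝ →ᵃ[ℝ] E)
    simpa [Function.comp_def, AffineMap.lineMap_apply, add_comm] using h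
  have h := hline.le_slope_of_hasDerivAt (Set.mem_univ 0) (Set.mem_univ 1) zero_lt_one
    (hasDerivAt_comp_add_smul hf x (y - x) 0)
  simp only [slope_def_field, zero_smul, one_smul, add_zero, add_sub_cancel, sub_zero,
    div_one] at h
  linarith

/-- The descent lemma: the quadratic upper bound for a function with Lipschitz gradient. -/
lemma le_add_inner_gradient_add_sq {E : Type*} [NormedAddCommGroup E] [InnerProductSpace ℝ E]
    [CompleteSpace E] {f : E → ℝ} {β : ℝ} (hf : Differentiable ℝ f)
    (hs : ∀ u v, ‖gradient f u - gradient f v‖ ≤ β * ‖u - v‖) (x y : E) :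
    f y ≤ f x + ⟪gradient f x, y - x⟫ + β / 2 * ‖y - x‖ ^ 2 := by
  set d := y - x with hd
  have hderiv (t : ℝ) : HasDerivAt
      (fun s : ℝ => f (x + s • d) - (s * ⟪gradient f x, d⟫ + β / 2 * ‖d‖ ^ 2 * s ^ 2))
      (⟪gradient f (x + t • d), d⟫ - (⟪gradient f x, d⟫ + β * ‖d‖ ^ 2 * t)) t := by
    have hq := (((hasDerivAt_id t).mul_const ⟪gradient f x, d⟫).add
      ((hasDerivAt_pow 2 t).const_mul (β / 2 * ‖d‖ ^ 2)))
    refine ((hasDerivAt_comp_add_smul hf x d t).sub hq).congr_deriv ?_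
    push_cast
    ring
  have hanti := antitoneOn_of_deriv_nonpos (convex_Icc (0 : ℝ) 1)
    (fun t _ => (hderiv t).continuousAt.continuousWithinAt)
    (fun t _ => (hderiv t).differentiableAt.differentiableWithinAt)
    (fun t ht => by
      rw [interior_Icc] at ht
      rw [(hderiv t).deriv, ← sub_sub, ← inner_sub_left, sub_nonpos]
      calc ⟪gradient f (x + t • d) - gradient f x, d⟫
          ≤ ‖gradient f (x + t • d) - gradient f x‖ * ‖d‖ := real_inner_le_norm _ _
        _ ≤ β * ‖x + t • d - x‖ * ‖d‖ := by gcongr; exact hs _ _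
        _ = β * ‖d‖ ^ 2 * t := by
          rw [add_sub_cancel_left, norm_smul, Real.norm_of_nonneg ht.1.le]
          ring)
  have h := hanti (Set.left_mem_Icc.2 zero_le_one) (Set.right_mem_Icc.2 zero_le_one) zero_le_one
  simp only [zero_smul, one_smul, add_zero, hd, add_sub_cancel, one_mul, one_pow, mul_one,
    zero_mul, ne_eq, OfNat.ofNat_ne_zero, not_false_eq_true, zero_pow, mul_zero, sub_zero] at h
  linarith

/-- The descent lemma recentred at a third point `z`. -/
lemma le_add_inner_gradient_add_sq_add_sq {E : Type*} [NormedAddCommGroup E]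
    [InnerProductSpace ℝ E] [CompleteSpace E] {f : E → ℝ} {β : ℝ} (hf : Differentiable ℝ f)
    (hs : ∀ u v, ‖gradient f u - gradient f v‖ ≤ β * ‖u - v‖) (x y z : E) :
    f y ≤ f x + ⟪gradient f x, y - x⟫ + (β * ‖y - z‖ ^ 2 + β * ‖x - z‖ ^ 2) := by
  have h := le_add_inner_gradient_add_sq hf hs x y
  have hpar := parallelogram_law_with_norm ℝ (y - z) (x - z)
  rw [sub_sub_sub_cancel_right] at hpar
  have hnonneg : 0 ≤ β * ‖y - z + (x - z)‖ := by
    simpa using (norm_nonneg _).trans (hs (y - z + (x - z)) 0)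
  have hmul := mul_nonneg hnonneg (norm_nonneg (y - z + (x - z)))
  linear_combination h + hmul / 2 + β / 2 * hpar

theorem statement18
    {n N : ℕ} (hn : 0 < n)
    (β : ℝ)
    (f : Fin n → Vec N → ℝ)
    (hcvx : ∀ i, ConvexOn ℝ Set.univ (f i))
    (hdiff : ∀ i, Differentiable ℝ (f i))
    (hsmooth : ∀ i, ∀ u v : Vec N,
      ‖gradient (f i) u - gradient (f i) v‖ ≤ β * ‖u - v‖)
    (favg : Vec N → ℝ) (hfavg : ∀ z, favg z = (n : ℝ)⁻¹ * ∑ i, f i z)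
    (x : Fin n → Vec N)
    (xbar : Vec N) (hxbar : xbar = (n : ℝ)⁻¹ • ∑ i, x i)
    (g : Vec N) (hg : g = (n : ℝ)⁻¹ • ∑ i, gradient (f i) (x i))
    (fhat : ℝ)
    (hfhat : fhat = (n : ℝ)⁻¹ * ∑ i, (f i (x i) + ⟪gradient (f i) (x i), xbar - x i⟫)) :
    ∀ ω : Vec N,
      fhat + ⟪g, ω - xbar⟫ ≤ favg ω ∧
      favg ω ≤ fhat + ⟪g, ω - xbar⟫ + β * ‖ω - xbar‖ ^ 2 +
        β / n * ∑ i, ‖x i - xbar‖ ^ 2 := by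
  intro ω
  have hn0 : (n : ℝ) ≠ 0 := Nat.cast_ne_zero.2 hn.ne'
  have hmodel : fhat + ⟪g, ω - xbar⟫ =
      (n : ℝ)⁻¹ * ∑ i, (f i (x i) + ⟪gradient (f i) (x i), ω - x i⟫) := by
    rw [hfhat, hg, real_inner_smul_left, sum_inner, ← mul_add, ← Finset.sum_add_distrib]
    congr 1
    refine Finset.sum_congr rfl fun i _ => ?_
    rw [add_assoc, ← inner_add_right, add_comm (xbar - x i), sub_add_sub_cancel]
  have herr : β * ‖ω - xbar‖ ^ 2 + β / n * ∑ i, ‖x i - xbar‖ ^ 2 =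
      (n : ℝ)⁻¹ * ∑ i, (β * ‖ω - xbar‖ ^ 2 + β * ‖x i - xbar‖ ^ 2) := by
    rw [Finset.sum_add_distrib, ← Finset.mul_sum, Finset.sum_const, Finset.card_univ,
      Fintype.card_fin, nsmul_eq_mul]
    field_simp
    rw [mul_add, Finset.mul_sum, mul_assoc]
  rw [add_assoc (fhat + _), herr, hmodel, hfavg, ← mul_add, ← Finset.sum_add_distrib]
  constructor
  · gcongr with i
    exact (hcvx i).add_inner_gradient_le (hdiff i) (x i) ω
  · gcongr with i
    exact le_add_inner_gradient_add_sq_add_sq (hdiff i) (hsmooth i) (x i) ω xbar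
end
end

section
/- (Discrete convolution bound via Gershgorin) Let θ ∈ (0,1), let t be a natural number, and let a₀, a₁, …, a_t be real numbers. Then Σ_{k=0}^{t} ( Σ_{ℓ=0}^{k} θ^{k−ℓ} a_ℓ )² ≤ (3/(1−θ)²) · Σ_{ℓ=0}^{t} a_ℓ². -/
open scoped BigOperators

theorem sum_range_succ_pow_sub_mul (θ : ℝ) (a : ℕ → ℝ) (k : ℕ) :
    ∑ l ∈ Finset.range (k + 2), θ ^ (k + 1 - l) * a l =
      θ * ∑ l ∈ Finset.range (k + 1), θ ^ (k - l) * a l + a (k + 1) := by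
  rw [Finset.sum_range_succ, Finset.mul_sum]
  congr 1
  · refine Finset.sum_congr rfl fun l hl => ?_
    rw [Nat.succ_sub (Finset.mem_range_succ_iff.mp hl), pow_succ]
    ring
  · simp

theorem sum_sq_geometric_convolution_add_le {θ : ℝ} (hθ0 : 0 ≤ θ) (a : ℕ → ℝ) (t : ℕ) :
    (1 - θ) ^ 2 *
          ∑ k ∈ Finset.range (t + 1), (∑ l ∈ Finset.range (k + 1), θ ^ (k - l) * a l) ^ 2 +
        θ * (1 - θ) * (∑ l ∈ Finset.range (t + 1), θ ^ (t - l) * a l) ^ 2 ≤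
      ∑ l ∈ Finset.range (t + 1), a l ^ 2 := by
  induction t with
  | zero =>
    simp only [zero_add, Finset.sum_range_one, Nat.sub_self, pow_zero, one_mul]
    nlinarith [mul_nonneg hθ0 (sq_nonneg (a 0))]
  | succ t ih =>
    rw [Finset.sum_range_succ _ (t + 1), Finset.sum_range_succ (fun l => a l ^ 2) (t + 1),
      sum_range_succ_pow_sub_mul]
    set s := ∑ l ∈ Finset.range (t + 1), θ ^ (t - l) * a l
    linear_combination ih + mul_nonneg hθ0 (sq_nonneg (a (t + 1) - (1 - θ) * s))

theorem statement19
    (θ : ℝ) (hθ0 : 0 < θ) (hθ1 : θ < 1)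
    (t : ℕ) (a : ℕ → ℝ) :
    ∑ k ∈ Finset.range (t + 1), (∑ l ∈ Finset.range (k + 1), θ ^ (k - l) * a l) ^ 2 ≤
      3 / (1 - θ) ^ 2 * ∑ l ∈ Finset.range (t + 1), a l ^ 2 := by
  have hθ : 0 < 1 - θ := sub_pos.mpr hθ1
  have hA : 0 ≤ ∑ l ∈ Finset.range (t + 1), a l ^ 2 := Finset.sum_nonneg fun l _ => sq_nonneg _
  have hlast := mul_nonneg (mul_pos hθ0 hθ).le
    (sq_nonneg (∑ l ∈ Finset.range (t + 1), θ ^ (t - l) * a l))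
  rw [div_mul_eq_mul_div, le_div_iff₀ (by positivity)]
  linarith [sum_sq_geometric_convolution_add_le hθ0.le a t]
end
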